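/- arXiv:2003.01794 — 7 statements merged into one kernel-verified Lean document; each statement's English description precedes it below -/
import Mathlib

section
/- Suppose the closed ball of radius γ > 0 centered at y is contained in M = conv{p_1,…,p_N}. Then for every k ≥ 1 the greedy iterates satisfy ‖u^k − y‖² ≤ (max(D, D²/2, D²/(2γ)))² / k², where D is the diameter of M. -/
open scoped BigOperators

noncomputable section

/-- Greedy Frank–Wolfe–type iterates: `u 0 = 0`, and for `k ≥ 1`,
`u k = ((k-1)/k) • u (k-1) + (1/k) • q` where `q` is chosen among the points
`p i` to minimize `‖u k - y‖²`. -/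
def GreedyIter {m N : ℕ} (p : Fin N → EuclideanSpace ℝ (Fin m))
    (y : EuclideanSpace ℝ (Fin m)) (u : ℕ → EuclideanSpace ℝ (Fin m)) : Prop :=
  u 0 = 0 ∧ ∀ k : ℕ, 1 ≤ k → ∃ i : Fin N,
    u k = (((k : ℝ) - 1) / k) • u (k - 1) + ((1 : ℝ) / k) • p i ∧
    ∀ j : Fin N,
      ‖u k - y‖ ^ 2 ≤ ‖(((k : ℝ) - 1) / k) • u (k - 1) + ((1 : ℝ) / k) • p j - y‖ ^ 2

theorem exists_descent {m N : ℕ}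
    (p : Fin N → EuclideanSpace ℝ (Fin m)) (y : EuclideanSpace ℝ (Fin m))
    (γ : ℝ) (hγ : 0 < γ)
    (hball : Metric.closedBall y γ ⊆ convexHull ℝ (Set.range p))
    (e : EuclideanSpace ℝ (Fin m)) : ∃ j, inner ℝ e (p j - y) ≤ -(γ * ‖e‖) := by
  by_contra! h
  have hx : y - (γ / ‖e‖) • e ∈ Metric.closedBall y γ := by
    rw [Metric.mem_closedBall, dist_eq_norm]
    have : y - (γ / ‖e‖) • e - y = -((γ / ‖e‖) • e) := by abel
    rw [this, norm_neg, norm_smul, Real.norm_of_nonneg (by positivity)]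
    rcases eq_or_ne ‖e‖ 0 with h0 | h0
    · rw [h0]; simpa using hγ.le
    · rw [div_mul_cancel₀ _ h0]
  have hconv : Convex ℝ {x : EuclideanSpace ℝ (Fin m) |
      inner ℝ e y - γ * ‖e‖ < inner ℝ e x} :=
    convex_halfSpace_gt (f := fun x => inner ℝ e x)
      ⟨fun a b => inner_add_right _ _ _, fun c a => by simp [inner_smul_right]⟩ _
  have hsub : Set.range p ⊆ {x : EuclideanSpace ℝ (Fin m) |
      inner ℝ e y - γ * ‖e‖ < inner ℝ e x} := by
    rintro _ ⟨j, rfl⟩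
    have := h j
    rw [inner_sub_right] at this
    simp only [Set.mem_ofPred_eq]
    linarith
  have := convexHull_min hsub hconv (hball hx)
  simp only [Set.mem_ofPred_eq, inner_sub_right, inner_smul_right,
    real_inner_self_eq_norm_sq] at this
  have h2 : γ / ‖e‖ * ‖e‖ ^ 2 = γ * ‖e‖ := by
    rcases eq_or_ne ‖e‖ 0 with h0 | h0
    · rw [h0]; simp
    · field_simp
  linarith

/-- If the closed ball of radius `γ > 0` around `y` is contained in
`M = conv{p₁,…,p_N}`, then the greedy iterates satisfy
`‖u^k − y‖² ≤ (max(D, D²/2, D²/(2γ)))² / k²` where `D` is the diameter of `M`. -/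
theorem statement2 {m N : ℕ} (hN : 0 < N)
    (p : Fin N → EuclideanSpace ℝ (Fin m)) (y : EuclideanSpace ℝ (Fin m))
    (γ : ℝ) (hγ : 0 < γ)
    (hball : Metric.closedBall y γ ⊆ convexHull ℝ (Set.range p))
    (D : ℝ) (hD : D = Metric.diam (convexHull ℝ (Set.range p)))
    (u : ℕ → EuclideanSpace ℝ (Fin m)) (hu : GreedyIter p y u) :
    ∀ k : ℕ, 1 ≤ k →
      ‖u k - y‖ ^ 2 ≤ (max (max D (D ^ 2 / 2)) (D ^ 2 / (2 * γ))) ^ 2 / (k : ℝ) ^ 2 := by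
  obtain ⟨-, hu⟩ := hu
  set R := max (max D (D ^ 2 / 2)) (D ^ 2 / (2 * γ)) with hR
  have hD0 : 0 ≤ D := hD ▸ Metric.diam_nonneg
  have hDR : D ≤ R := (le_max_left _ _).trans (le_max_left _ _)
  have hDR2 : D ^ 2 ≤ 2 * γ * R := by
    have : D ^ 2 / (2 * γ) ≤ R := le_max_right _ _
    rw [div_le_iff₀ (by positivity)] at this
    linarith
  have hR0 : 0 ≤ R := hD0.trans hDR
  have hbd : Bornology.IsBounded (convexHull ℝ (Set.range p)) :=
    isBounded_convexHull.2 (Set.finite_range p).isBounded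
  have hy : y ∈ convexHull ℝ (Set.range p) := hball (Metric.mem_closedBall_self hγ.le)
  have hpy : ∀ j, ‖p j - y‖ ≤ D := fun j => by
    rw [← dist_eq_norm, hD]
    exact Metric.dist_le_diam_of_mem hbd (subset_convexHull ℝ _ ⟨j, rfl⟩) hy
  have key : ∀ k : ℕ, ‖(k : ℝ) • (u k - y)‖ ≤ R := by
    intro k
    induction k with
    | zero => simpa using hR0
    | succ n ih =>
      obtain ⟨i, -, hmin⟩ := hu (n + 1) (by omega)
      obtain ⟨j, hj⟩ := exists_descent p y γ hγ hball ((n : ℝ) • (u n - y))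
      set e := (n : ℝ) • (u n - y) with he
      have hm := hmin j
      have hn : ((n : ℝ) + 1) ≠ 0 := by positivity
      have heq : ((((n + 1 : ℕ) : ℝ) - 1) / ((n + 1 : ℕ) : ℝ)) • u (n + 1 - 1)
          + ((1 : ℝ) / ((n + 1 : ℕ) : ℝ)) • p j - y
          = ((1 : ℝ) / ((n : ℝ) + 1)) • (e + (p j - y)) := by
        rw [he, Nat.add_sub_cancel]
        push_cast
        ext t
        simp
        field_simp
        ring
      rw [heq] at hm
      have hm' := (sq_le_sq₀ (norm_nonneg _) (norm_nonneg _)).1 hm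
      rw [norm_smul, Real.norm_of_nonneg (by positivity)] at hm'
      have h1 : ‖((n + 1 : ℕ) : ℝ) • (u (n + 1) - y)‖ ≤ ‖e + (p j - y)‖ := by
        rw [norm_smul, Real.norm_of_nonneg (by positivity)]
        push_cast
        calc ((n : ℝ) + 1) * ‖u (n + 1) - y‖
            ≤ ((n : ℝ) + 1) * (1 / ((n : ℝ) + 1) * ‖e + (p j - y)‖) := by gcongr
          _ = _ := by field_simp
      refine h1.trans ?_
      refine (sq_le_sq₀ (norm_nonneg _) hR0).1 ?_
      rw [norm_add_sq_real]
      have h2 : ‖p j - y‖ ^ 2 ≤ D ^ 2 := by gcongr; exact hpy j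
      have h3 : D ^ 2 ≤ R ^ 2 := by gcongr
      have h4 := norm_nonneg e
      rcases le_total (2 * γ) R with h | h
      · nlinarith [mul_nonneg h4 (sub_nonneg.2 ih),
          mul_nonneg (sub_nonneg.2 h) (sub_nonneg.2 ih)]
      · nlinarith [mul_nonneg h4 (sub_nonneg.2 ih), mul_nonneg h4 (sub_nonneg.2 h)]
  intro k hk
  have hk0 : (0 : ℝ) < k := by exact_mod_cast hk
  have := key k
  rw [norm_smul, Real.norm_of_nonneg hk0.le] at this
  rw [le_div_iff₀ (by positivity), ← mul_pow]
  gcongr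
  linarith
end
end

section
/- For every k ≥ 2 the greedy iterates satisfy the recursive inequality ℓ(u^k) ≤ (1 − 1/k)·ℓ(u^{k−1}) + (1/k)·L* + D²/k², where L* = min_{u ∈ M} ℓ(u) and D is the diameter of M. -/
open scoped BigOperators

noncomputable section

/-- For every `k ≥ 2` the greedy iterates satisfy the recursion
`ℓ(u^k) ≤ (1 − 1/k)·ℓ(u^{k−1}) + (1/k)·L* + D²/k²`, where `ℓ(u) = ‖u − y‖²`,
`L* = min_{u ∈ M} ℓ(u)` and `D` is the diameter of `M = conv{p₁,…,p_N}`. -/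
theorem statement3 {m N : ℕ} (hN : 0 < N)
    (p : Fin N → EuclideanSpace ℝ (Fin m)) (y : EuclideanSpace ℝ (Fin m))
    (D : ℝ) (hD : D = Metric.diam (convexHull ℝ (Set.range p)))
    (Lstar : ℝ)
    (hLstar : IsLeast ((fun u => ‖u - y‖ ^ 2) '' convexHull ℝ (Set.range p)) Lstar)
    (u : ℕ → EuclideanSpace ℝ (Fin m)) (hu : GreedyIter p y u) :
    ∀ k : ℕ, 2 ≤ k →
      ‖u k - y‖ ^ 2 ≤
        (1 - 1 / (k : ℝ)) * ‖u (k - 1) - y‖ ^ 2 + (1 / (k : ℝ)) * Lstar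
          + D ^ 2 / (k : ℝ) ^ 2 := by
  classical
  have hmem : ∀ n : ℕ, u (n + 1) ∈ convexHull ℝ (Set.range p) := by
    intro n
    induction n with
    | zero =>
      obtain ⟨i, hi, -⟩ := hu.2 1 le_rfl
      have h1 : u (0 + 1) = p i := by simpa using hi
      rw [h1]
      exact subset_convexHull ℝ _ ⟨i, rfl⟩
    | succ n ih =>
      obtain ⟨i, hi, -⟩ := hu.2 (n + 1 + 1) (by omega)
      rw [hi]
      have hk : (0 : ℝ) < ((n + 1 + 1 : ℕ) : ℝ) := by positivity
      refine (convex_convexHull ℝ (Set.range p)) (by simpa using ih)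
        (subset_convexHull ℝ _ ⟨i, rfl⟩) ?_ ?_ ?_
      · apply div_nonneg _ hk.le
        push_cast
        linarith [Nat.cast_nonneg (α := ℝ) n]
      · positivity
      · field_simp
        ring
  intro k hk
  have hw : u (k - 1) ∈ convexHull ℝ (Set.range p) := by
    have h := hmem (k - 2)
    rwa [show k - 2 + 1 = k - 1 by omega] at h
  obtain ⟨_, -, hmin⟩ := hu.2 k (by omega)
  generalize u (k - 1) = w at *
  obtain ⟨⟨x, hx, hxL⟩, -⟩ := hLstar
  have hq : ∃ j, inner ℝ (w - y) (p j) ≤ inner ℝ (w - y) x := by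
    by_contra! hcon
    have hc : Convex ℝ {z : EuclideanSpace ℝ (Fin m) |
        inner ℝ (w - y) x < inner ℝ (w - y) z} :=
      convex_halfSpace_gt (innerₛₗ ℝ (w - y)).isLinear _
    have hsub := convexHull_min (s := Set.range p) (by rintro _ ⟨j, rfl⟩; exact hcon j) hc
    have hxx : inner ℝ (w - y) x < inner ℝ (w - y) x := hsub hx
    exact lt_irrefl _ hxx
  obtain ⟨j, hj⟩ := hq
  have hb : Bornology.IsBounded (convexHull ℝ (Set.range p)) :=
    isBounded_convexHull.2 (Set.finite_range p).isBounded
  have hdist : ‖p j - w‖ ≤ D := by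
    rw [hD, ← dist_eq_norm]
    exact Metric.dist_le_diam_of_mem hb (subset_convexHull ℝ _ ⟨j, rfl⟩) hw
  have hd2 : ‖p j - w‖ ^ 2 ≤ D ^ 2 := by gcongr
  have hk0 : (0 : ℝ) < k := by
    have : 0 < k := by omega
    exact_mod_cast this
  refine (hmin j).trans ?_
  have e1 : (((k : ℝ) - 1) / k) • w + ((1 : ℝ) / k) • p j - y
      = (w - y) + ((1 : ℝ) / k) • (p j - w) := by
    rw [sub_div, div_self hk0.ne']
    module
  have e2 : ‖x - y‖ ^ 2 = ‖w - y‖ ^ 2 + 2 * inner ℝ (w - y) (x - w) + ‖x - w‖ ^ 2 := by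
    rw [← norm_add_sq_real]
    congr 2
    abel
  have hxL' : ‖x - y‖ ^ 2 = Lstar := hxL
  rw [e1, norm_add_sq_real, norm_smul, inner_smul_right, mul_pow, Real.norm_eq_abs, sq_abs]
  rw [inner_sub_right] at e2 ⊢
  have ht : (0 : ℝ) < 1 / (k : ℝ) := by positivity
  rw [show D ^ 2 / (k : ℝ) ^ 2 = (1 / (k : ℝ)) ^ 2 * D ^ 2 by field_simp]
  generalize (1 / (k : ℝ)) = t at *
  have h1 : t ^ 2 * ‖p j - w‖ ^ 2 ≤ t ^ 2 * D ^ 2 := by gcongr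
  have h2 : t * (2 * (inner ℝ (w - y) (p j) - inner ℝ (w - y) w)) ≤
      t * (Lstar - ‖w - y‖ ^ 2) := by
    apply mul_le_mul_of_nonneg_left _ ht.le
    nlinarith [sq_nonneg ‖x - w‖]
  linarith
end
end

section
/- Suppose the closed ball of radius γ > 0 centered at y is contained in M = conv{p_1,…,p_N}. Define w^k := k·(y − u^k) for the greedy iterates u^k (so w^0 = 0). Then for every k ≥ 0, ‖w^{k+1}‖² ≤ ‖w^k‖² − 2γ‖w^k‖ + D², where D is the diameter of M. -/
open scoped BigOperators

noncomputable section

/-- If the closed ball of radius `γ > 0` around `y` is contained in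
`M = conv{p₁,…,p_N}`, then with `w^k := k (y − u^k)` we have, for all `k ≥ 0`,
`‖w^{k+1}‖² ≤ ‖w^k‖² − 2γ‖w^k‖ + D²`, where `D` is the diameter of `M`. -/
theorem statement5 {m N : ℕ} (hN : 0 < N)
    (p : Fin N → EuclideanSpace ℝ (Fin m)) (y : EuclideanSpace ℝ (Fin m))
    (γ : ℝ) (hγ : 0 < γ)
    (hball : Metric.closedBall y γ ⊆ convexHull ℝ (Set.range p))
    (D : ℝ) (hD : D = Metric.diam (convexHull ℝ (Set.range p)))
    (u : ℕ → EuclideanSpace ℝ (Fin m)) (hu : GreedyIter p y u)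
    (w : ℕ → EuclideanSpace ℝ (Fin m)) (hw : ∀ k : ℕ, w k = (k : ℝ) • (y - u k)) :
    ∀ k : ℕ, ‖w (k + 1)‖ ^ 2 ≤ ‖w k‖ ^ 2 - 2 * γ * ‖w k‖ + D ^ 2 := by
  intro k
  obtain ⟨j, hj⟩ : ∃ j, γ * ‖w k‖ ≤ inner ℝ (w k) (p j - y) := by
    by_contra! hc
    have hsub : convexHull ℝ (Set.range p) ⊆
        {x | inner ℝ (w k) x < γ * ‖w k‖ + inner ℝ (w k) y} := by
      apply convexHull_min
      · rintro _ ⟨j, rfl⟩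
        have := hc j
        rw [inner_sub_right] at this
        simp only [Set.mem_setOf_eq]
        linarith
      · exact convex_halfSpace_lt (f := fun x => inner ℝ (w k) x)
          ⟨fun a b => inner_add_right _ _ _, fun c a => by simp [inner_smul_right]⟩ _
    by_cases h0 : ‖w k‖ = 0
    · have h1 := hc ⟨0, hN⟩
      rw [norm_eq_zero] at h0
      simp [h0] at h1
    · have hmem : y + (γ / ‖w k‖) • w k ∈ Metric.closedBall y γ := by
        rw [Metric.mem_closedBall, dist_eq_norm, add_sub_cancel_left, norm_smul, Real.norm_eq_abs,
          abs_of_nonneg (by positivity), div_mul_cancel₀ _ h0]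
      have h2 := hsub (hball hmem)
      simp only [Set.mem_setOf_eq, inner_add_right, inner_smul_right,
        real_inner_self_eq_norm_sq] at h2
      have h3 : γ / ‖w k‖ * ‖w k‖ ^ 2 = γ * ‖w k‖ := by field_simp
      linarith
  have hyM : y ∈ convexHull ℝ (Set.range p) :=
    hball (Metric.mem_closedBall_self hγ.le)
  have hpM : p j ∈ convexHull ℝ (Set.range p) := subset_convexHull ℝ _ ⟨j, rfl⟩
  have hb : Bornology.IsBounded (convexHull ℝ (Set.range p)) :=
    isBounded_convexHull.2 (Set.finite_range p).isBounded
  have hdist : ‖p j - y‖ ≤ D := by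
    rw [hD, ← dist_eq_norm]
    exact Metric.dist_le_diam_of_mem hb hpM hyM
  have hsq : ‖p j - y‖ ^ 2 ≤ D ^ 2 := by gcongr
  obtain ⟨i, -, hmin⟩ := hu.2 (k + 1) (by omega)
  have hm := hmin j
  have hk : ((k : ℝ) + 1) ≠ 0 := by positivity
  have e1 : ‖w (k + 1)‖ ^ 2 = ((k : ℝ) + 1) ^ 2 * ‖u (k + 1) - y‖ ^ 2 := by
    rw [hw, norm_smul, mul_pow, norm_sub_rev, Real.norm_eq_abs, sq_abs]
    push_cast
    rfl
  have e2 : w k - (p j - y) = -(((k : ℝ) + 1) • ((((((k + 1 : ℕ) : ℝ)) - 1) / ((k + 1 : ℕ) : ℝ))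
      • u (k + 1 - 1) + ((1 : ℝ) / ((k + 1 : ℕ) : ℝ)) • p j - y)) := by
    rw [hw]
    push_cast
    simp only [add_tsub_cancel_right, smul_sub, smul_add, smul_smul, add_sub_cancel_right]
    rw [mul_div_cancel₀ _ hk, mul_div_cancel₀ _ hk]
    module
  have e3 : ‖w k - (p j - y)‖ ^ 2 = ((k : ℝ) + 1) ^ 2 * ‖((((((k + 1 : ℕ) : ℝ)) - 1) /
      ((k + 1 : ℕ) : ℝ)) • u (k + 1 - 1) + ((1 : ℝ) / ((k + 1 : ℕ) : ℝ)) • p j - y)‖ ^ 2 := by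
    rw [e2, norm_neg, norm_smul, mul_pow, Real.norm_eq_abs, sq_abs]
  have e4 : ‖w (k + 1)‖ ^ 2 ≤ ‖w k - (p j - y)‖ ^ 2 := by
    rw [e1, e3]
    exact mul_le_mul_of_nonneg_left hm (by positivity)
  rw [norm_sub_sq_real] at e4
  linarith
end
end

section
/- Let C > 0 and γ > 0, and let (z_k)_{k≥0} be a sequence of real numbers with z_0 = 0 and |z_{k+1}|² ≤ |z_k|² − 2γ|z_k| + C for all k ≥ 0. Then |z_k| ≤ max(√C, C/2, C/(2γ)) for all k ≥ 0. -/
/-- If `z 0 = 0` and `|z_{k+1}|² ≤ |z_k|² − 2γ|z_k| + C` for all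
`k ≥ 0`, with `C, γ > 0`, then `|z_k| ≤ max(√C, C/2, C/(2γ))` for all `k ≥ 0`. -/
theorem statement6 (C γ : ℝ) (hC : 0 < C) (hγ : 0 < γ) (z : ℕ → ℝ)
    (hz0 : z 0 = 0)
    (hrec : ∀ k : ℕ, |z (k + 1)| ^ 2 ≤ |z k| ^ 2 - 2 * γ * |z k| + C) :
    ∀ k : ℕ, |z k| ≤ max (max (Real.sqrt C) (C / 2)) (C / (2 * γ)) := by
  have h1 : Real.sqrt C ≤ max (max (Real.sqrt C) (C / 2)) (C / (2 * γ)) :=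
    le_trans (le_max_left _ _) (le_max_left _ _)
  have h2 : C / (2 * γ) ≤ max (max (Real.sqrt C) (C / 2)) (C / (2 * γ)) := le_max_right _ _
  generalize max (max (Real.sqrt C) (C / 2)) (C / (2 * γ)) = M at h1 h2 ⊢
  have hM : 0 ≤ M := le_trans (Real.sqrt_nonneg C) h1
  have h3 : C ≤ M ^ 2 := (Real.sqrt_le_left hM).mp h1
  have h4 : C ≤ M * (2 * γ) := (div_le_iff₀ (by positivity)).mp h2
  intro k
  induction k with
  | zero => simpa [hz0] using hM
  | succ k ih =>
    have hr := hrec k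
    have ht := abs_nonneg (z k)
    refine (pow_le_pow_iff_left₀ (abs_nonneg _) hM two_ne_zero).mp ?_
    rcases le_total (|z k|) (2 * γ) with h | h
    · nlinarith [mul_nonneg ht (sub_nonneg.mpr h)]
    · nlinarith [mul_le_mul ih (sub_le_sub_right ih (2 * γ)) (sub_nonneg.mpr h) hM]
end

section
/- Let S ⊆ ℝ^m be nonempty, let F ⊆ ℝ^m be a nonempty finite set, and let ε ≥ 0 be such that for every s ∈ S there exists f ∈ F with ‖s − f‖ ≤ ε. If the closed ball of radius r centered at y is contained in conv(S) and ε < r, then the closed ball of radius r − ε centered at y is contained in conv(F). -/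
/-- Let `S ⊆ ℝ^m` be nonempty, `F ⊆ ℝ^m` nonempty and finite, and
`ε ≥ 0` such that every point of `S` is within distance `ε` of some point of `F`.
If the closed ball of radius `r` around `y` is contained in `conv S` and `ε < r`,
then the closed ball of radius `r − ε` around `y` is contained in `conv F`. -/
theorem statement7 {m : ℕ} (S F : Set (EuclideanSpace ℝ (Fin m)))
    (hS : S.Nonempty) (hFfin : F.Finite) (hFne : F.Nonempty)
    (ε : ℝ) (hε : 0 ≤ ε)
    (hcover : ∀ s ∈ S, ∃ f ∈ F, ‖s - f‖ ≤ ε)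
    (y : EuclideanSpace ℝ (Fin m)) (r : ℝ)
    (hball : Metric.closedBall y r ⊆ convexHull ℝ S)
    (hεr : ε < r) :
    Metric.closedBall y (r - ε) ⊆ convexHull ℝ F := by
  intro x hx
  by_contra hxF
  obtain ⟨g, u, hg, hu⟩ := geometric_hahn_banach_closed_point (convex_convexHull ℝ F)
    (hFfin.isClosed_convexHull ℝ) hxF
  obtain ⟨v, rfl⟩ := (InnerProductSpace.toDual ℝ (EuclideanSpace ℝ (Fin m))).surjective g
  simp only [InnerProductSpace.toDual_apply_apply] at hg hu
  have hv : v ≠ 0 := by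
    rintro rfl
    obtain ⟨f, hf⟩ := hFne
    have := hg f (subset_convexHull ℝ F hf)
    simp only [inner_zero_left] at this hu
    linarith
  have hN : 0 < ‖v‖ := norm_pos_iff.2 hv
  have hconv : Convex ℝ {z : EuclideanSpace ℝ (Fin m) | inner ℝ v z < u + ‖v‖ * ε} :=
    convex_halfSpace_lt (InnerProductSpace.toDual ℝ _ v).toLinearMap.isLinear _
  have hsub : convexHull ℝ S ⊆ {z | inner ℝ v z < u + ‖v‖ * ε} := by
    refine convexHull_min (fun s hs => ?_) hconv
    obtain ⟨f, hf, hsf⟩ := hcover s hs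
    have h1 := hg f (subset_convexHull ℝ F hf)
    have h2 := real_inner_le_norm v (s - f)
    have h3 := mul_le_mul_of_nonneg_left hsf hN.le
    rw [inner_sub_right] at h2
    simp only [Set.mem_setOf_eq]
    linarith
  have hp : y + (r / ‖v‖) • v ∈ Metric.closedBall y r := by
    rw [mem_closedBall_iff_norm, add_sub_cancel_left, norm_smul, norm_div, norm_norm,
      div_mul_cancel₀ _ hN.ne', Real.norm_of_nonneg (hε.trans hεr.le)]
  have h1 := hsub (hball hp)
  simp only [Set.mem_setOf_eq, inner_add_right, inner_smul_right,
    real_inner_self_eq_norm_sq] at h1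
  have h2 : r / ‖v‖ * ‖v‖ ^ 2 = ‖v‖ * r := by field_simp
  have h3 := real_inner_le_norm v (x - y)
  rw [mem_closedBall_iff_norm] at hx
  have h4 := mul_le_mul_of_nonneg_left hx hN.le
  rw [inner_sub_right] at h3
  rw [h2] at h1
  linarith [mul_sub ‖v‖ r ε]
end

section
/- Let ρ be a Borel probability measure on ℝ^d with compact support, let φ : ℝ^d → ℝ^m be Lipschitz continuous, and assume the density regularity condition: there exists r̄ > 0 such that for every r₀ ∈ (0, r̄] there exists p₀ > 0 with ρ(closed ball of radius r₀ centered at θ) ≥ p₀ for every θ ∈ supp(ρ). Then for every ε > 0 and δ ∈ (0,1) there exists N₀ such that for all N ≥ N₀, with probability at least 1 − δ over i.i.d. samples θ̄_1,…,θ̄_N from ρ, one has sup_{θ ∈ supp(ρ)} min_{1≤i≤N} ‖φ(θ) − φ(θ̄_i)‖ ≤ ε. -/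
open MeasureTheory

noncomputable section

/-- The support of a measure on a metric measurable space: the set of points all of
whose closed balls of positive radius have positive measure. -/
def msupport {α : Type*} [PseudoMetricSpace α] [MeasurableSpace α]
    (ρ : Measure α) : Set α :=
  {θ | ∀ r : ℝ, 0 < r → 0 < ρ (Metric.closedBall θ r)}

/-- Let `ρ` be a Borel probability measure on `ℝ^d` with compact
support, `φ : ℝ^d → ℝ^m` Lipschitz, and assume the density regularity condition.
Then for all `ε > 0` and `δ ∈ (0,1)`, for all sufficiently large `N`, with
probability at least `1 − δ` over i.i.d. samples `θ̄₁,…,θ̄_N ~ ρ`, every point of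
`supp ρ` has its feature `φ(θ)` within distance `ε` of some sampled feature. -/
theorem statement9 {d m : ℕ} (ρ : Measure (EuclideanSpace ℝ (Fin d)))
    [IsProbabilityMeasure ρ]
    (hcompact : IsCompact (msupport ρ))
    (φ : EuclideanSpace ℝ (Fin d) → EuclideanSpace ℝ (Fin m))
    (K : NNReal) (hφ : LipschitzWith K φ)
    (hreg : ∃ rbar : ℝ, 0 < rbar ∧ ∀ r₀ ∈ Set.Ioc (0 : ℝ) rbar, ∃ p₀ : ℝ, 0 < p₀ ∧
      ∀ θ ∈ msupport ρ, ENNReal.ofReal p₀ ≤ ρ (Metric.closedBall θ r₀)) :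
    ∀ ε : ℝ, 0 < ε → ∀ δ ∈ Set.Ioo (0 : ℝ) 1, ∃ N₀ : ℕ, ∀ N : ℕ, N₀ ≤ N →
      ENNReal.ofReal (1 - δ) ≤
        (Measure.pi fun _ : Fin N => ρ)
          {θs : Fin N → EuclideanSpace ℝ (Fin d) |
            ∀ θ ∈ msupport ρ, ∃ i : Fin N, ‖φ θ - φ (θs i)‖ ≤ ε} := by
  intro ε hε δ hδ
  have hK : (0 : ℝ) ≤ K := K.2
  obtain ⟨r, hr, hr2⟩ : ∃ r : ℝ, 0 < r ∧ (K : ℝ) * (2 * r) ≤ ε := by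
    refine ⟨ε / (2 * (K + 1)), by positivity, ?_⟩
    have h1 : (K : ℝ) * (2 * (ε / (2 * (K + 1)))) = ε * (K / (K + 1)) := by
      field_simp
    rw [h1]
    have h2 : (K : ℝ) / (K + 1) ≤ 1 := by
      rw [div_le_one (by positivity)]
      linarith
    nlinarith
  obtain ⟨t, hts, htfin, hcover⟩ := hcompact.finite_cover_balls hr
  lift t to Finset (EuclideanSpace ℝ (Fin d)) using htfin
  have hlt : ∀ c ∈ t, ρ (Metric.closedBall c r)ᶜ < 1 := by
    intro c hc
    rw [prob_compl_eq_one_sub Metric.isClosed_closedBall.measurableSet]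
    exact ENNReal.sub_lt_self ENNReal.one_ne_top one_ne_zero (hts hc r hr).ne'
  have hlim : Filter.Tendsto (fun N : ℕ => ∑ c ∈ t, (ρ (Metric.closedBall c r)ᶜ) ^ N)
      Filter.atTop (nhds 0) := by
    have h := tendsto_finsetSum (f := fun c (N : ℕ) => (ρ (Metric.closedBall c r)ᶜ) ^ N) t
      (fun c hc => ENNReal.tendsto_pow_atTop_nhds_zero_of_lt_one (hlt c hc))
    simpa using h
  have hev := hlim.eventually (gt_mem_nhds (ENNReal.ofReal_pos.2 hδ.1))
  obtain ⟨N₀, hN₀⟩ := Filter.eventually_atTop.1 hev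
  refine ⟨N₀, fun N hN => ?_⟩
  set B : Set (Fin N → EuclideanSpace ℝ (Fin d)) :=
    ⋃ c ∈ t, Set.univ.pi fun _ : Fin N => (Metric.closedBall c r)ᶜ with hB
  have hBm : MeasurableSet B := by
    refine Finset.measurableSet_biUnion t fun c _ => ?_
    exact MeasurableSet.univ_pi fun _ => Metric.isClosed_closedBall.measurableSet.compl
  have hBle : (Measure.pi fun _ : Fin N => ρ) B ≤ ENNReal.ofReal δ := by
    refine (measure_biUnion_finset_le t _).trans ?_
    refine le_trans (le_of_eq ?_) (hN₀ N hN).le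
    refine Finset.sum_congr rfl fun c _ => ?_
    rw [Measure.pi_pi]
    simp
  calc ENNReal.ofReal (1 - δ) = 1 - ENNReal.ofReal δ := by
        rw [ENNReal.ofReal_sub _ hδ.1.le, ENNReal.ofReal_one]
    _ ≤ 1 - (Measure.pi fun _ : Fin N => ρ) B := tsub_le_tsub_left hBle _
    _ = (Measure.pi fun _ : Fin N => ρ) Bᶜ := (prob_compl_eq_one_sub hBm).symm
    _ ≤ _ := by
        refine measure_mono fun θs hθs θ hθ => ?_
        obtain ⟨c, hc, hθc⟩ := Set.mem_iUnion₂.1 (hcover hθ)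
        have h3 : ∃ i, θs i ∈ Metric.closedBall c r := by
          by_contra hcon
          push Not at hcon
          exact hθs (Set.mem_iUnion₂.2 ⟨c, hc, fun i _ => hcon i⟩)
        obtain ⟨i, hi⟩ := h3
        refine ⟨i, ?_⟩
        rw [← dist_eq_norm]
        refine (hφ.dist_le_mul _ _).trans (le_trans ?_ hr2)
        refine mul_le_mul_of_nonneg_left ?_ hK
        have h4 := dist_triangle_right θ (θs i) c
        have h5 := Metric.mem_ball.1 hθc
        have h6 := Metric.mem_closedBall.1 hi
        linarith
end
end

section
/- Let ρ be a Borel probability measure on ℝ^d with compact support, let φ : ℝ^d → ℝ^m be Lipschitz continuous, let y ∈ ℝ^m and γ* > 0, and suppose the closed ball of radius γ* centered at y is contained in conv{φ(θ) : θ ∈ supp(ρ)}. Assume the density regularity condition: there exists r̄ > 0 such that for every r₀ ∈ (0, r̄] there exists p₀ > 0 with ρ(closed ball of radius r₀ centered at θ) ≥ p₀ for every θ ∈ supp(ρ). Then for every δ ∈ (0,1) there exists N₀ such that for all N ≥ N₀, with probability at least 1 − δ over i.i.d. samples θ_1,…,θ_N from ρ, the closed ball of radius γ*/2 centered at y is contained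 in conv{φ(θ_1),…,φ(θ_N)}. -/
open MeasureTheory

noncomputable section

/-- If every point of `S` is within `ε` of the finite family `x`, and the hull of `S` contains
the closed ball of radius `R + ε`, the hull of `x` contains the closed ball of radius `R`. -/
theorem ball_subset_of_net {m N : ℕ} (S : Set (EuclideanSpace ℝ (Fin m)))
    (x : Fin N → EuclideanSpace ℝ (Fin m)) (y : EuclideanSpace ℝ (Fin m)) (R ε : ℝ)
    (hε : 0 ≤ ε)
    (hS : Metric.closedBall y (R + ε) ⊆ convexHull ℝ S)
    (hx : ∀ s ∈ S, ∃ i, dist s (x i) ≤ ε) :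
    Metric.closedBall y R ⊆ convexHull ℝ (Set.range x) := by
  intro z hz
  by_contra hzC
  have hcl : IsClosed (convexHull ℝ (Set.range x)) :=
    (Set.finite_range x).isClosed_convexHull ℝ
  obtain ⟨f, u, hf, hu⟩ := geometric_hahn_banach_closed_point
    (convex_convexHull ℝ (Set.range x)) hcl hzC
  -- the Riesz representative of f
  set a := (InnerProductSpace.toDual ℝ (EuclideanSpace ℝ (Fin m))).symm f with ha
  have hfa : ∀ v, f v = inner ℝ a v := fun v => by simp [ha]
  set v : EuclideanSpace ℝ (Fin m) := ‖a‖⁻¹ • a with hv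
  have hv1 : ‖v‖ ≤ 1 := by
    rw [hv, norm_smul, norm_inv, norm_norm]
    exact inv_mul_le_one
  have hfv : f v = ‖a‖ := by
    rw [hfa, hv, real_inner_smul_right, real_inner_self_eq_norm_sq]
    rcases eq_or_ne ‖a‖ 0 with h | h
    · simp [h]
    · field_simp
  have hw : z + ε • v ∈ convexHull ℝ S := by
    apply hS
    rw [Metric.mem_closedBall, dist_eq_norm] at hz ⊢
    have h1 : ‖ε • v‖ ≤ ε := by
      rw [norm_smul, Real.norm_of_nonneg hε]
      nlinarith
    have h2 : z + ε • v - y = (z - y) + ε • v := by abel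
    rw [h2]
    exact (norm_add_le _ _).trans (add_le_add hz h1)
  have hsub : convexHull ℝ S ⊆ {p | f p ≤ u + ε * ‖a‖} := by
    apply convexHull_min
    · intro s hs
      obtain ⟨i, hi⟩ := hx s hs
      have h1 : f (x i) < u := hf _ (subset_convexHull ℝ _ ⟨i, rfl⟩)
      have h2 : f (s - x i) ≤ ‖a‖ * ‖s - x i‖ := by
        rw [hfa]; exact real_inner_le_norm _ _
      rw [map_sub] at h2
      rw [dist_eq_norm] at hi
      have h3 := mul_le_mul_of_nonneg_left hi (norm_nonneg a)
      simp only [Set.mem_setOf_eq]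
      linarith
    · exact convex_halfSpace_le f.toLinearMap.isLinear _
  have h := hsub hw
  simp only [Set.mem_setOf_eq, map_add, map_smul, smul_eq_mul, hfv] at h
  linarith

/-- Let `ρ` be a Borel probability measure on `ℝ^d` with compact
support, `φ : ℝ^d → ℝ^m` Lipschitz, and suppose the closed ball of radius `γ* > 0`
around `y` is contained in `conv{φ(θ) : θ ∈ supp ρ}`. Assume density regularity.
Then for every `δ ∈ (0,1)`, for all sufficiently large `N`, with probability at
least `1 − δ` over i.i.d. samples `θ₁,…,θ_N ~ ρ`, the closed ball of radius `γ*/2`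
around `y` is contained in `conv{φ(θ₁),…,φ(θ_N)}`. -/
theorem statement10 {d m : ℕ} (ρ : Measure (EuclideanSpace ℝ (Fin d)))
    [IsProbabilityMeasure ρ]
    (hcompact : IsCompact (msupport ρ))
    (φ : EuclideanSpace ℝ (Fin d) → EuclideanSpace ℝ (Fin m))
    (K : NNReal) (hφ : LipschitzWith K φ)
    (y : EuclideanSpace ℝ (Fin m)) (γs : ℝ) (hγs : 0 < γs)
    (hball : Metric.closedBall y γs ⊆ convexHull ℝ (φ '' msupport ρ))
    (hreg : ∃ rbar : ℝ, 0 < rbar ∧ ∀ r₀ ∈ Set.Ioc (0 : ℝ) rbar, ∃ p₀ : ℝ, 0 < p₀ ∧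
      ∀ θ ∈ msupport ρ, ENNReal.ofReal p₀ ≤ ρ (Metric.closedBall θ r₀)) :
    ∀ δ ∈ Set.Ioo (0 : ℝ) 1, ∃ N₀ : ℕ, ∀ N : ℕ, N₀ ≤ N →
      ENNReal.ofReal (1 - δ) ≤
        (Measure.pi fun _ : Fin N => ρ)
          {θs : Fin N → EuclideanSpace ℝ (Fin d) |
            Metric.closedBall y (γs / 2) ⊆
              convexHull ℝ (Set.range fun i : Fin N => φ (θs i))} := by
  clear hreg
  intro δ hδ
  obtain ⟨r, hr, hrK⟩ : ∃ r : ℝ, 0 < r ∧ (K : ℝ) * (2 * r) ≤ γs / 2 := by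
    refine ⟨γs / (4 * (K + 1)), by positivity, ?_⟩
    have hK : (0 : ℝ) ≤ K := K.2
    have : (K : ℝ) * (2 * (γs / (4 * (K + 1)))) = (K / (K + 1)) * (γs / 2) := by
      field_simp; norm_num
    rw [this]
    have h1 : (K : ℝ) / (K + 1) ≤ 1 := by
      rw [div_le_one (by positivity)]; linarith
    nlinarith
  obtain ⟨t, htS, htfin, htc⟩ := hcompact.finite_cover_balls hr
  have hlim : Filter.Tendsto
      (fun N : ℕ => ∑ c ∈ htfin.toFinset, (ρ (Metric.closedBall c r)ᶜ) ^ N)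
      Filter.atTop (nhds 0) := by
    have h0 : (0 : ENNReal) = ∑ c ∈ htfin.toFinset, 0 := by simp
    rw [h0]
    refine tendsto_finsetSum _ fun c hc => ?_
    apply ENNReal.tendsto_pow_atTop_nhds_zero_of_lt_one
    rw [prob_compl_eq_one_sub Metric.isClosed_closedBall.measurableSet]
    exact ENNReal.sub_lt_self ENNReal.one_ne_top one_ne_zero
      (htS (htfin.mem_toFinset.1 hc) r hr).ne'
  have hδ' : (0 : ENNReal) < ENNReal.ofReal δ := ENNReal.ofReal_pos.2 hδ.1
  obtain ⟨N₀, hN₀⟩ := Filter.eventually_atTop.1 (hlim.eventually_lt_const hδ')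
  refine ⟨N₀, fun N hN => ?_⟩
  have hlt := hN₀ N hN
  set A := {θs : Fin N → EuclideanSpace ℝ (Fin d) |
            Metric.closedBall y (γs / 2) ⊆
              convexHull ℝ (Set.range fun i : Fin N => φ (θs i))} with hA
  set μ := (Measure.pi fun _ : Fin N => ρ) with hμ
  have hsub : Aᶜ ⊆ ⋃ c ∈ htfin.toFinset,
      Set.pi Set.univ (fun _ : Fin N => (Metric.closedBall c r)ᶜ) := by
    intro θs hθ
    by_contra hcon
    apply hθ
    simp only [Set.mem_iUnion, Set.mem_pi, Set.mem_univ, true_implies, not_exists, not_forall,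
      Set.mem_compl_iff, not_not, htfin.mem_toFinset] at hcon
    refine ball_subset_of_net (φ '' msupport ρ) (fun i => φ (θs i)) y (γs / 2) (γs / 2)
      (by linarith) (by rwa [add_halves]) ?_
    rintro _ ⟨θ, hθS, rfl⟩
    obtain ⟨c, hc, hcθ⟩ := Set.mem_iUnion₂.1 (htc hθS)
    obtain ⟨i, hi⟩ := hcon c hc
    refine ⟨i, (hφ.dist_le_mul _ _).trans (le_trans ?_ hrK)⟩
    apply mul_le_mul_of_nonneg_left _ K.2
    have h1 := dist_triangle_right θ (θs i) c
    rw [Metric.mem_ball] at hcθ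
    rw [Metric.mem_closedBall] at hi
    linarith
  have hbad : μ Aᶜ ≤ ENNReal.ofReal δ := by
    refine (measure_mono hsub).trans ((measure_biUnion_finset_le _ _).trans ?_)
    refine le_trans (le_of_eq ?_) hlt.le
    refine Finset.sum_congr rfl fun c _ => ?_
    rw [hμ, Measure.pi_pi]
    simp
  have hone : (1 : ENNReal) ≤ μ A + μ Aᶜ := by
    have h1 : μ Set.univ = 1 := measure_univ
    rw [← h1, ← Set.union_compl_self A]
    exact measure_union_le _ _
  rw [ENNReal.ofReal_sub _ hδ.1.le, ENNReal.ofReal_one, tsub_le_iff_right]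
  exact hone.trans (by gcongr)
end
end
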